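/- Suppose k = 3 and the model selection procedure consists only of the second F test: the confidence interval is I_ξ if F_ξ ≤ ℓ_ξ and I otherwise. Then the coverage probability of the resulting confidence interval, viewed as a function of γ = β/σ, is a function of (γ₅ − γ₄, γ₆ − γ₄) only. That is, if β, β' ∈ ℝ⁶ and σ, σ' > 0 satisfy β₅/σ − β₄/σ = β'₅/σ' − β'₄/σ' and β₆/σ − β₄/σ = β'₆/σ' − β'₄/σ', then the coverage probabilities for (β,σ) and (β',σ') are equal. -/

import Mathlib

open Matrix MeasureTheory ProbabilityTheory

/-- The coverage probability `P_{β,σ}(θ ∈ CI)` in the `k = 3` case when the model selection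
procedure consists only of the second F test: the confidence interval is `Iξ` if `Fξ ≤ ℓξ`
and `I` otherwise. The error vector `ε` has the `N(0, σ²Iₙ)` distribution, `Y = Xβ + ε`. -/
noncomputable def coverageProbSecondTest (n : ℕ) (X : Matrix (Fin n) (Fin 6) ℝ)
    (Cξ : Matrix (Fin 6) (Fin 2) ℝ) (a : Fin 6 → ℝ) (ℓξ t₂ t₃ : ℝ)
    (β : Fin 6 → ℝ) (σ : ℝ) : ℝ :=
  ((Measure.pi fun _ : Fin n => gaussianReal 0 ⟨σ ^ 2, sq_nonneg σ⟩)
    {ε : Fin n → ℝ |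
      let Y := X.mulVec β + ε
      let βh := ((Xᵀ * X)⁻¹ * Xᵀ).mulVec Y
      let R := fun b : Fin 6 → ℝ => (Y - X.mulVec b) ⬝ᵥ (Y - X.mulVec b)
      let m : ℝ := (n : ℝ) - 6
      let W₂₂ := Cξᵀ * (Xᵀ * X)⁻¹ * Cξ
      let ξh := Cξᵀ.mulVec βh
      let Fξ := (m / 2) * (ξh ⬝ᵥ W₂₂⁻¹.mulVec ξh) / R βh
      let Gξ := (1 : Matrix (Fin 6) (Fin 6) ℝ) - (Xᵀ * X)⁻¹ * Cξ * W₂₂⁻¹ * Cξᵀ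
      let v₁₁ := a ⬝ᵥ ((Xᵀ * X)⁻¹).mulVec a
      let w₂₁ := Cξᵀ.mulVec (((Xᵀ * X)⁻¹).mulVec a)
      let wstar := v₁₁ - w₂₁ ⬝ᵥ W₂₂⁻¹.mulVec w₂₁
      let θ := a ⬝ᵥ β
      (Fξ ≤ ℓξ ∧
        θ ∈ Set.Icc
          (a ⬝ᵥ Gξ.mulVec βh - t₂ * Real.sqrt (R (Gξ.mulVec βh) / (m + 2)) * Real.sqrt wstar)
          (a ⬝ᵥ Gξ.mulVec βh
            + t₂ * Real.sqrt (R (Gξ.mulVec βh) / (m + 2)) * Real.sqrt wstar)) ∨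
      (ℓξ < Fξ ∧
        θ ∈ Set.Icc
          (a ⬝ᵥ βh - t₃ * Real.sqrt (R βh / m) * Real.sqrt v₁₁)
          (a ⬝ᵥ βh + t₃ * Real.sqrt (R βh / m) * Real.sqrt v₁₁))}).toReal

/-- Scaling by `c` carries the centred product Gaussian of variance `v` to that of variance
`c ^ 2 * v`. -/
lemma map_smul_pi_gaussianReal (n : ℕ) (c : ℝ) (v w : NNReal) (h : (w : ℝ) = c ^ 2 * v) :
    (Measure.pi fun _ : Fin n => gaussianReal 0 v).map (fun ε => c • ε)
      = Measure.pi fun _ : Fin n => gaussianReal 0 w := by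
  have hp : MeasurePreserving (c * ·) (gaussianReal 0 v) (gaussianReal 0 w) := by
    refine ⟨by fun_prop, ?_⟩
    rw [gaussianReal_map_const_mul, mul_zero]
    congr 1
    exact NNReal.coe_injective h.symm
  exact (measurePreserving_pi (fun _ : Fin n => gaussianReal 0 v)
    (fun _ : Fin n => gaussianReal 0 w) fun _ => hp).map_eq

/-- An affine change of units `x ↦ c * x + d` with `c > 0` preserves membership in an interval
whose half-width is a multiple of the square root of a quadratic quantity. -/
lemma affine_mem_Icc_iff {c : ℝ} (hc : 0 < c) (d x y t r q w : ℝ) :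
    c * x + d ∈ Set.Icc (c * y + d - t * √(c ^ 2 * r / q) * √w)
        (c * y + d + t * √(c ^ 2 * r / q) * √w)
      ↔ x ∈ Set.Icc (y - t * √(r / q) * √w) (y + t * √(r / q) * √w) := by
  rw [mul_div_assoc, Real.sqrt_mul (sq_nonneg c), Real.sqrt_sq hc.le, Set.mem_Icc, Set.mem_Icc]
  have e : t * (c * √(r / q)) * √w = c * (t * √(r / q) * √w) := by ring
  rw [e]
  constructor <;> rintro ⟨h₁, h₂⟩ <;> constructor <;> nlinarith

/-- Rescaling the parameter and the errors by `c > 0` and shifting the parameter by an element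
of the kernel of `Cξᵀ` leaves the coverage probability unchanged. -/
theorem coverageProbSecondTest_smul_add (n : ℕ)
    (X : Matrix (Fin n) (Fin 6) ℝ) (hX : IsUnit (Xᵀ * X).det)
    (Cξ : Matrix (Fin 6) (Fin 2) ℝ) (a : Fin 6 → ℝ) (ℓξ t₂ t₃ : ℝ)
    (β δ : Fin 6 → ℝ) (hδ : Cξᵀ.mulVec δ = 0) (c σ : ℝ) (hc : 0 < c) :
    coverageProbSecondTest n X Cξ a ℓξ t₂ t₃ (c • β + δ) (c * σ)
      = coverageProbSecondTest n X Cξ a ℓξ t₂ t₃ β σ := by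
  unfold coverageProbSecondTest
  generalize hv : (⟨σ ^ 2, sq_nonneg σ⟩ : NNReal) = v
  generalize hw : (⟨(c * σ) ^ 2, sq_nonneg (c * σ)⟩ : NNReal) = w
  have hvw : (w : ℝ) = c ^ 2 * v := by
    rw [← hv, ← hw]
    exact mul_pow c σ 2
  rw [← map_smul_pi_gaussianReal n c v w hvw]
  have hmap := (MeasurableEquiv.smul₀ (α := Fin n → ℝ) c hc.ne').map_apply
    (μ := Measure.pi fun _ : Fin n => gaussianReal 0 v)
  rw [MeasurableEquiv.coe_smul₀] at hmap
  rw [hmap]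
  congr 2
  ext ε
  simp only [Set.mem_preimage, Set.mem_ofPred_eq]
  have hY : X.mulVec (c • β + δ) + c • ε = c • (X.mulVec β + ε) + X.mulVec δ := by
    rw [mulVec_add, mulVec_smul, smul_add]
    abel
  rw [hY]
  generalize X.mulVec β + ε = Y
  have hβ : ((Xᵀ * X)⁻¹ * Xᵀ).mulVec (c • Y + X.mulVec δ)
      = c • ((Xᵀ * X)⁻¹ * Xᵀ).mulVec Y + δ := by
    rw [mulVec_add, mulVec_smul, mulVec_mulVec, Matrix.mul_assoc, nonsing_inv_mul _ hX,
      one_mulVec]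
  rw [hβ]
  generalize ((Xᵀ * X)⁻¹ * Xᵀ).mulVec Y = b
  have hG : ∀ M : Matrix (Fin 6) (Fin 2) ℝ,
      ((1 : Matrix (Fin 6) (Fin 6) ℝ) - M * Cξᵀ).mulVec (c • b + δ)
        = c • ((1 : Matrix (Fin 6) (Fin 6) ℝ) - M * Cξᵀ).mulVec b + δ := by
    intro M
    rw [mulVec_add, mulVec_smul, sub_mulVec _ _ δ, ← mulVec_mulVec, hδ, mulVec_zero, one_mulVec,
      sub_zero]
  have hR : ∀ v : Fin 6 → ℝ,
      (c • Y + X.mulVec δ - X.mulVec (c • v + δ)) ⬝ᵥ (c • Y + X.mulVec δ - X.mulVec (c • v + δ))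
        = c ^ 2 * ((Y - X.mulVec v) ⬝ᵥ (Y - X.mulVec v)) := by
    intro v
    have : c • Y + X.mulVec δ - X.mulVec (c • v + δ) = c • (Y - X.mulVec v) := by
      rw [mulVec_add, mulVec_smul, smul_sub]
      abel
    rw [this, smul_dotProduct, dotProduct_smul, smul_eq_mul, smul_eq_mul]
    ring
  have hξ : Cξᵀ.mulVec (c • b + δ) = c • Cξᵀ.mulVec b := by
    rw [mulVec_add, mulVec_smul, hδ, add_zero]
  have ha : ∀ v : Fin 6 → ℝ, a ⬝ᵥ (c • v + δ) = c * (a ⬝ᵥ v) + a ⬝ᵥ δ := by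
    intro v
    rw [dotProduct_add, dotProduct_smul, smul_eq_mul]
  have hF : ∀ (q : ℝ) (M : Matrix (Fin 2) (Fin 2) ℝ) (z : Fin 2 → ℝ) (r : ℝ),
      q * ((c • z) ⬝ᵥ M.mulVec (c • z)) / (c ^ 2 * r) = q * (z ⬝ᵥ M.mulVec z) / r := by
    intro q M z r
    rw [mulVec_smul, smul_dotProduct, dotProduct_smul, smul_eq_mul, smul_eq_mul,
      ← mul_div_mul_left (q * (z ⬝ᵥ M.mulVec z)) r (pow_ne_zero 2 hc.ne')]
    congr 1
    ring
  rw [hG, hR, hR, hξ, hF, ha, ha, ha, affine_mem_Icc_iff hc, affine_mem_Icc_iff hc]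

/-- **Lemma 2.** For `k = 3`, if the model selection procedure consists only of
the second F test, then the coverage probability of the subsequently constructed confidence
interval, as a function of `γ = β/σ`, depends only on `(γ₅ − γ₄, γ₆ − γ₄)`
(1-based coordinates). -/
theorem coverageProbSecondTest_depends_only_on_slope_differences
    (n : ℕ) (hn : 7 ≤ n)
    (X : Matrix (Fin n) (Fin 6) ℝ) (hX : IsUnit (Xᵀ * X).det)
    (Cξ : Matrix (Fin 6) (Fin 2) ℝ)
    (hCξ : ∀ (b : Fin 6 → ℝ) (j : Fin 2),
      Cξᵀ.mulVec b j = b 3 - b ⟨4 + (j : ℕ), by omega⟩)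
    (hW : IsUnit (Cξᵀ * (Xᵀ * X)⁻¹ * Cξ).det)
    (a : Fin 6 → ℝ) (ℓξ t₂ t₃ : ℝ) (hℓξ : 0 < ℓξ) (ht₂ : 0 < t₂) (ht₃ : 0 < t₃)
    (β β' : Fin 6 → ℝ) (σ σ' : ℝ) (hσ : 0 < σ) (hσ' : 0 < σ')
    (h₅ : β 4 / σ - β 3 / σ = β' 4 / σ' - β' 3 / σ')
    (h₆ : β 5 / σ - β 3 / σ = β' 5 / σ' - β' 3 / σ') :
    coverageProbSecondTest n X Cξ a ℓξ t₂ t₃ β σ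
      = coverageProbSecondTest n X Cξ a ℓξ t₂ t₃ β' σ' := by
  set c := σ' / σ with hcdef
  have hc : 0 < c := div_pos hσ' hσ
  have hσc : σ' = c * σ := by rw [hcdef]; field_simp
  have hδ : Cξᵀ.mulVec (β' - c • β) = 0 := by
    field_simp at h₅ h₆
    ext j
    rw [hCξ]
    fin_cases j
    · simp only [Pi.sub_apply, Pi.smul_apply, smul_eq_mul, Pi.zero_apply, hcdef]
      field_simp
      change β' 3 * σ - σ' * β 3 - (σ * β' 4 - σ' * β 4) = σ * 0
      linarith
    · simp only [Pi.sub_apply, Pi.smul_apply, smul_eq_mul, Pi.zero_apply, hcdef]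
      field_simp
      change β' 3 * σ - σ' * β 3 - (σ * β' 5 - σ' * β 5) = σ * 0
      linarith
  have h := coverageProbSecondTest_smul_add n X hX Cξ a ℓξ t₂ t₃ β (β' - c • β) hδ c σ hc
  rw [add_sub_cancel, ← hσc] at h
  exact h.symm
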